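/- Let m ∈ ℕ and a, b, s ∈ ℝ satisfy a + b ≥ 0, s ≤ min{a, b}, and s ≤ a + b − m/2, with the last inequality strict if −s = m/2 or a = m/2 or b = m/2. Then there exists C > 0 such that for all measurable functions F, G : ℝ^m → [0,∞] one has (∫_{ℝ^m} ⟨x⟩^{2s} (∫_{ℝ^m} F(y) G(x−y) dy)² dx)^{1/2} ≤ C · (∫_{ℝ^m} ⟨y⟩^{2a} F(y)² dy)^{1/2} · (∫_{ℝ^m} ⟨z⟩^{2b} G(z)² dz)^{1/2}, where all integrals are Lebesgue integrals with values in [0,∞]. -/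

import Mathlib

open scoped ENNReal
open MeasureTheory

/-- The Japanese bracket `⟨x⟩ = (1 + |x|²)^(1/2)`. -/
noncomputable def jb {E : Type*} [NormedAddCommGroup E] (x : E) : ℝ :=
  Real.sqrt (1 + ‖x‖ ^ 2)

section JapaneseBracket

variable {E : Type*} [NormedAddCommGroup E]

lemma one_le_jb (x : E) : 1 ≤ jb x :=
  Real.one_le_sqrt.2 (by nlinarith [sq_nonneg ‖x‖])

lemma jb_pos (x : E) : 0 < jb x := one_pos.trans_le (one_le_jb x)

lemma norm_le_jb (x : E) : ‖x‖ ≤ jb x := Real.le_sqrt_of_sq_le (by linarith)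

lemma jb_le_jb {x y : E} (h : ‖x‖ ≤ ‖y‖) : jb x ≤ jb y := by
  unfold jb; gcongr

lemma jb_le_two_mul_jb {x y : E} (h : ‖x‖ ≤ 2 * ‖y‖) : jb x ≤ 2 * jb y := by
  unfold jb
  rw [show (2 : ℝ) = √(2 ^ 2) by simp, ← Real.sqrt_mul (by positivity)]
  apply Real.sqrt_le_sqrt
  nlinarith [norm_nonneg x, norm_nonneg y]

lemma measurable_jb [MeasurableSpace E] [OpensMeasurableSpace E] :
    Measurable (jb : E → ℝ) := by
  unfold jb; fun_prop

/-- The weight `⟨x⟩ ^ p` as an extended nonnegative real. -/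
noncomputable def jbPow (p : ℝ) (x : E) : ℝ≥0∞ := ENNReal.ofReal (jb x ^ p)

lemma jbPow_mul (p q : ℝ) (x : E) : jbPow p x * jbPow q x = jbPow (p + q) x := by
  rw [jbPow, jbPow, jbPow, ← ENNReal.ofReal_mul (by have := jb_pos x; positivity),
    Real.rpow_add (jb_pos x)]

@[simp]
lemma jbPow_zero (x : E) : jbPow 0 x = 1 := by simp [jbPow]

lemma jbPow_sq (p : ℝ) (x : E) : jbPow p x ^ 2 = jbPow (2 * p) x := by
  rw [sq, jbPow_mul, two_mul]

lemma measurable_jbPow [MeasurableSpace E] [OpensMeasurableSpace E] (p : ℝ) :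
    Measurable (jbPow p : E → ℝ≥0∞) :=
  (measurable_jb.pow_const p).ennreal_ofReal

lemma jbPow_le_jbPow {p : ℝ} (hp : 0 ≤ p) {x y : E} (h : ‖x‖ ≤ ‖y‖) :
    jbPow p x ≤ jbPow p y :=
  ENNReal.ofReal_le_ofReal (Real.rpow_le_rpow (jb_pos x).le (jb_le_jb h) hp)

lemma jbPow_anti {p : ℝ} (hp : p ≤ 0) {x y : E} (h : ‖x‖ ≤ ‖y‖) :
    jbPow p y ≤ jbPow p x :=
  ENNReal.ofReal_le_ofReal (Real.rpow_le_rpow_of_nonpos (jb_pos x) (jb_le_jb h) hp)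

lemma jbPow_le_mul_of_comparable (p : ℝ) {x y : E} (hxy : ‖x‖ ≤ 2 * ‖y‖)
    (hyx : ‖y‖ ≤ 2 * ‖x‖) : jbPow p x ≤ ENNReal.ofReal (2 ^ |p|) * jbPow p y := by
  have hx := jb_pos x
  have hy := jb_pos y
  rw [jbPow, jbPow, ← ENNReal.ofReal_mul (by positivity)]
  apply ENNReal.ofReal_le_ofReal
  rcases le_total 0 p with hp | hp
  · rw [abs_of_nonneg hp, ← Real.mul_rpow (by norm_num) hy.le]
    exact Real.rpow_le_rpow hx.le (jb_le_two_mul_jb hxy) hp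
  · have h2 : jb y / 2 ≤ jb x := by linarith [jb_le_two_mul_jb hyx]
    refine (Real.rpow_le_rpow_of_nonpos (by positivity) h2 hp).trans_eq ?_
    rw [abs_of_nonpos hp, Real.div_rpow hy.le (by norm_num), Real.rpow_neg (by norm_num)]
    field_simp

end JapaneseBracket

section EuclideanIntegrals

variable {m : ℕ}

lemma lintegral_jbPow_lt_top {p : ℝ} (hp : (m : ℝ) < p) :
    ∫⁻ u : EuclideanSpace ℝ (Fin m), jbPow (-p) u < ∞ := by
  have h := (integrable_rpow_neg_one_add_norm_sq (E := EuclideanSpace ℝ (Fin m))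
    (μ := volume) (r := p) (by simpa using hp)).lintegral_lt_top
  refine (lintegral_congr fun u ↦ ?_).trans_lt h
  rw [jbPow, jb, Real.sqrt_eq_rpow, ← Real.rpow_mul (by positivity)]
  ring_nf

lemma setLIntegral_enorm_rpow_lt_top {p : ℝ} (hp0 : 0 ≤ p) (hp : p < m) :
    ∫⁻ u : EuclideanSpace ℝ (Fin m) in Metric.closedBall 0 1, ‖u‖ₑ ^ (-p) < ∞ := by
  have hm : 1 ≤ m := by
    have : (0 : ℝ) < m := hp0.trans_lt hp
    exact_mod_cast this
  have : Nonempty (Fin m) := ⟨⟨0, hm⟩⟩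
  have h := (integrableOn_ball_of_norm_le_rpow (E := EuclideanSpace ℝ (Fin m)) (μ := volume)
    (by simpa using hm) (f := fun u ↦ ‖u‖ ^ (-p)) (C := 1) (α := p) (r := 2)
    (by simpa using hp) (.of_forall fun u ↦ by
      rw [one_mul, Real.norm_of_nonneg (by positivity)])
    (measurable_norm.pow_const _).aestronglyMeasurable).lintegral_lt_top
  refine lt_of_le_of_lt ?_ h
  refine (lintegral_mono_set (Metric.closedBall_subset_ball one_lt_two)).trans_eq ?_
  refine lintegral_congr_ae (ae_restrict_of_ae ?_)
  filter_upwards [compl_mem_ae_iff.2 (measure_singleton (0 : EuclideanSpace ℝ (Fin m)))] with u hu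
  have hu : 0 < ‖u‖ := norm_pos_iff.2 hu
  rw [← ofReal_norm, ENNReal.ofReal_rpow_of_pos hu]

lemma setLIntegral_closedBall_enorm_rpow (p : ℝ) {R : ℝ} (hR : 0 < R) :
    ∫⁻ u : EuclideanSpace ℝ (Fin m) in Metric.closedBall 0 R, ‖u‖ₑ ^ (-p) =
      ENNReal.ofReal (R ^ (m - p)) *
        ∫⁻ u : EuclideanSpace ℝ (Fin m) in Metric.closedBall 0 1, ‖u‖ₑ ^ (-p) := by
  have hmap := Measure.map_addHaar_smul (volume : Measure (EuclideanSpace ℝ (Fin m))) hR.ne'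
  have hball : Metric.closedBall (0 : EuclideanSpace ℝ (Fin m)) 1 =
      (fun u ↦ R • u) ⁻¹' Metric.closedBall 0 R := by
    ext u
    simp [norm_smul, abs_of_pos hR, hR]
  have hscale : ∫⁻ u : EuclideanSpace ℝ (Fin m) in Metric.closedBall 0 1, ‖R • u‖ₑ ^ (-p) =
      ENNReal.ofReal (R ^ (-(m : ℝ))) *
        ∫⁻ u : EuclideanSpace ℝ (Fin m) in Metric.closedBall 0 R, ‖u‖ₑ ^ (-p) := by
    rw [hball, ← setLIntegral_map (f := fun u : EuclideanSpace ℝ (Fin m) ↦ ‖u‖ₑ ^ (-p))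
      measurableSet_closedBall (by fun_prop) (by fun_prop), hmap, Measure.restrict_smul,
      lintegral_smul_measure]
    simp [abs_of_pos hR, Real.rpow_neg hR.le]
  have hpull : ∫⁻ u : EuclideanSpace ℝ (Fin m) in Metric.closedBall 0 1, ‖R • u‖ₑ ^ (-p) =
      ENNReal.ofReal (R ^ (-p)) *
        ∫⁻ u : EuclideanSpace ℝ (Fin m) in Metric.closedBall 0 1, ‖u‖ₑ ^ (-p) := by
    rw [← lintegral_const_mul _ (by fun_prop)]
    refine lintegral_congr fun u ↦ ?_
    rw [enorm_smul, ENNReal.mul_rpow_of_ne_top enorm_ne_top enorm_ne_top,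
      Real.enorm_of_nonneg hR.le,
      ENNReal.ofReal_rpow_of_pos hR]
  rw [sub_eq_add_neg, Real.rpow_add hR, ENNReal.ofReal_mul (by positivity), mul_assoc, ← hpull,
    hscale, ← mul_assoc, ← ENNReal.ofReal_mul (by positivity), ← Real.rpow_add hR]
  simp

lemma exists_jbPow_mul_setLIntegral_le {α σ : ℝ} (hσ : 0 ≤ σ) (h : (m : ℝ) / 2 ≤ α + σ)
    (hα : α = (m : ℝ) / 2 → (m : ℝ) / 2 < α + σ) :
    ∃ C : ℝ≥0∞, C ≠ ∞ ∧ ∀ w : EuclideanSpace ℝ (Fin m),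
      jbPow (-(2 * σ)) w *
        ∫⁻ u in Metric.closedBall (0 : EuclideanSpace ℝ (Fin m)) ‖w‖, jbPow (-(2 * α)) u ≤ C := by
  rcases h.lt_or_eq with h | h
  · refine ⟨_, (lintegral_jbPow_lt_top (m := m) (p := 2 * (α + σ)) (by linarith)).ne, fun w ↦ ?_⟩
    rw [← lintegral_const_mul _ (measurable_jbPow _)]
    refine le_trans ?_ (setLIntegral_le_lintegral (Metric.closedBall 0 ‖w‖) _)
    refine setLIntegral_mono (measurable_jbPow _) fun u hu ↦ ?_
    rw [mem_closedBall_zero_iff] at hu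
    rw [mul_add, neg_add_rev, ← jbPow_mul]
    gcongr
    exact jbPow_anti (by linarith) hu
  have hαm : α < (m : ℝ) / 2 :=
    lt_of_le_of_ne (by linarith) fun h' ↦ (hα h').ne h
  rcases le_or_gt α 0 with hα0 | hα0
  · refine ⟨volume (Metric.closedBall (0 : EuclideanSpace ℝ (Fin m)) 1),
      measure_closedBall_lt_top.ne, fun w ↦ ?_⟩
    have hvol : volume (Metric.closedBall (0 : EuclideanSpace ℝ (Fin m)) ‖w‖) ≤
        jbPow m w * volume (Metric.closedBall (0 : EuclideanSpace ℝ (Fin m)) 1) := by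
      refine (measure_mono (Metric.closedBall_subset_closedBall (norm_le_jb w))).trans_eq ?_
      rw [Measure.addHaar_closedBall' _ _ (jb_pos w).le]
      simp [jbPow]
    calc jbPow (-(2 * σ)) w *
          ∫⁻ u in Metric.closedBall (0 : EuclideanSpace ℝ (Fin m)) ‖w‖, jbPow (-(2 * α)) u
        ≤ jbPow (-(2 * σ)) w * ∫⁻ u in Metric.closedBall (0 : EuclideanSpace ℝ (Fin m)) ‖w‖,
            jbPow (-(2 * α)) w := by
          gcongr jbPow (-(2 * σ)) w * ?_
          refine setLIntegral_mono measurable_const fun u hu ↦ ?_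
          exact jbPow_le_jbPow (by linarith) (mem_closedBall_zero_iff.1 hu)
      _ ≤ jbPow (-(2 * σ)) w * (jbPow (-(2 * α)) w *
            (jbPow m w * volume (Metric.closedBall (0 : EuclideanSpace ℝ (Fin m)) 1))) := by
          rw [setLIntegral_const]
          gcongr
      _ = volume (Metric.closedBall (0 : EuclideanSpace ℝ (Fin m)) 1) := by
          rw [← mul_assoc, ← mul_assoc, jbPow_mul, jbPow_mul,
            show -(2 * σ) + -(2 * α) + m = 0 by linarith, jbPow_zero, one_mul]
  · have : Nonempty (Fin m) := Fin.pos_iff_nonempty.1 <| by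
      have : (0 : ℝ) < m := by linarith
      exact_mod_cast this
    refine ⟨_, (setLIntegral_enorm_rpow_lt_top (m := m) (p := 2 * α) (by linarith)
      (by linarith)).ne, fun w ↦ ?_⟩
    calc jbPow (-(2 * σ)) w *
          ∫⁻ u in Metric.closedBall (0 : EuclideanSpace ℝ (Fin m)) ‖w‖, jbPow (-(2 * α)) u
        ≤ jbPow (-(2 * σ)) w * ∫⁻ u : EuclideanSpace ℝ (Fin m) in Metric.closedBall 0 (jb w),
            ‖u‖ₑ ^ (-(2 * α)) := by
          gcongr jbPow (-(2 * σ)) w * ?_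
          refine (lintegral_mono_set (Metric.closedBall_subset_closedBall
            (norm_le_jb w))).trans (lintegral_mono_ae (ae_restrict_of_ae ?_))
          filter_upwards [compl_mem_ae_iff.2
            (measure_singleton (0 : EuclideanSpace ℝ (Fin m)))] with u hu
          have hu : 0 < ‖u‖ := norm_pos_iff.2 hu
          rw [← ofReal_norm, ENNReal.ofReal_rpow_of_pos hu]
          exact ENNReal.ofReal_le_ofReal
            (Real.rpow_le_rpow_of_nonpos hu (norm_le_jb u) (by linarith))
      _ = _ := by
          rw [setLIntegral_closedBall_enorm_rpow _ (jb_pos w), ← mul_assoc]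
          change jbPow _ w * jbPow _ w * _ = _
          rw [jbPow_mul, show -(2 * σ) + (m - 2 * α) = 0 by linarith, jbPow_zero, one_mul]

end EuclideanIntegrals

lemma lintegral_mul_sq_le {Ω : Type*} [MeasurableSpace Ω] (μ : Measure Ω) {f g : Ω → ℝ≥0∞}
    (hf : AEMeasurable f μ) (hg : AEMeasurable g μ) :
    (∫⁻ y, f y * g y ∂μ) ^ 2 ≤ (∫⁻ y, f y ^ 2 ∂μ) * ∫⁻ y, g y ^ 2 ∂μ := by
  have h := ENNReal.lintegral_mul_le_Lp_mul_Lq μ Real.HolderConjugate.two_two hf hg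
  simp only [Pi.mul_apply, ENNReal.rpow_two] at h
  refine (pow_le_pow_left' h 2).trans_eq ?_
  rw [mul_pow, ← ENNReal.rpow_mul_natCast, ← ENNReal.rpow_mul_natCast]
  norm_num

lemma add_add_sq_le (x y z : ℝ≥0∞) : (x + y + z) ^ 2 ≤ 9 * (x ^ 2 + y ^ 2 + z ^ 2) := by
  set M := max (max x y) z
  have hx : x ≤ M := (le_max_left _ _).trans (le_max_left _ _)
  have hy : y ≤ M := (le_max_right _ _).trans (le_max_left _ _)
  have hz : z ≤ M := le_max_right _ _
  have hM : M ^ 2 ≤ x ^ 2 + y ^ 2 + z ^ 2 := by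
    rcases max_choice (max x y) z with h | h
    · rcases max_choice x y with h' | h'
      · rw [show M = x from h.trans h', add_assoc]; exact le_self_add
      · rw [show M = y from h.trans h', add_right_comm]; exact le_add_self
    · rw [show M = z from h]; exact le_add_self
  calc (x + y + z) ^ 2 ≤ (M + M + M) ^ 2 := by gcongr
    _ = 9 * M ^ 2 := by ring
    _ ≤ _ := by gcongr

section Convolution

variable {m : ℕ} {a b s : ℝ} {F G : EuclideanSpace ℝ (Fin m) → ℝ≥0∞}

lemma exists_lintegral_conv_sq_le_of_left_small (hsb : s ≤ b) (hs : s ≤ a + b - (m : ℝ) / 2)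
    (ha : a = (m : ℝ) / 2 → s < a + b - (m : ℝ) / 2) :
    ∃ C : ℝ≥0∞, C ≠ ∞ ∧ ∀ F G : EuclideanSpace ℝ (Fin m) → ℝ≥0∞, Measurable F → Measurable G →
      ∫⁻ x, jbPow (2 * s) x *
          (∫⁻ y in {y | ‖y‖ ≤ ‖x‖ ∧ ‖y‖ ≤ ‖x - y‖}, F y * G (x - y)) ^ 2 ≤
        C * (∫⁻ y, jbPow (2 * a) y * F y ^ 2) * ∫⁻ z, jbPow (2 * b) z * G z ^ 2 := by
  obtain ⟨C, hC, hbd⟩ := exists_jbPow_mul_setLIntegral_le (m := m) (α := a) (σ := b - s)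
    (by linarith) (by linarith) (fun h ↦ by linarith [ha h])
  refine ⟨ENNReal.ofReal (2 ^ |-(2 * b)|) * C, ENNReal.mul_ne_top ENNReal.ofReal_ne_top hC,
    fun F G hF hG ↦ ?_⟩
  set D := ENNReal.ofReal (2 ^ |-(2 * b)|)
  set A : EuclideanSpace ℝ (Fin m) → ℝ≥0∞ := fun y ↦ jbPow (2 * a) y * F y ^ 2 with hA
  set B : EuclideanSpace ℝ (Fin m) → ℝ≥0∞ := fun y ↦ jbPow (2 * b) y * G y ^ 2 with hB
  have hw (p : ℝ) := measurable_jbPow (E := EuclideanSpace ℝ (Fin m)) p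
  have hAm : Measurable A := by fun_prop
  have hBm : Measurable B := by fun_prop
  have hpt (x : EuclideanSpace ℝ (Fin m)) : jbPow (2 * s) x *
      (∫⁻ y in {y | ‖y‖ ≤ ‖x‖ ∧ ‖y‖ ≤ ‖x - y‖}, F y * G (x - y)) ^ 2 ≤
      D * C * ∫⁻ y, A y * B (x - y) := by
    set S := {y : EuclideanSpace ℝ (Fin m) | ‖y‖ ≤ ‖x‖ ∧ ‖y‖ ≤ ‖x - y‖}
    have hcs : (∫⁻ y in S, F y * G (x - y)) ^ 2 ≤ (∫⁻ y in S, A y * B (x - y)) *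
        ∫⁻ y in S, jbPow (-(2 * b)) (x - y) * jbPow (-(2 * a)) y := by
      have h := lintegral_mul_sq_le (volume.restrict S)
        (f := fun y ↦ jbPow a y * F y * (jbPow b (x - y) * G (x - y)))
        (g := fun y ↦ jbPow (-b) (x - y) * jbPow (-a) y) (by fun_prop) (by fun_prop)
      convert h using 4 with y y y
      · calc F y * G (x - y) = jbPow (a + -a) y * jbPow (b + -b) (x - y) * (F y * G (x - y)) := by
              simp
          _ = _ := by rw [← jbPow_mul, ← jbPow_mul]; ring
      · simp only [hA, hB, mul_pow, jbPow_sq]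
      · simp only [mul_pow, jbPow_sq, mul_neg]
    have hker : jbPow (2 * s) x * ∫⁻ y in S, jbPow (-(2 * b)) (x - y) * jbPow (-(2 * a)) y ≤
        D * C := by
      calc jbPow (2 * s) x * ∫⁻ y in S, jbPow (-(2 * b)) (x - y) * jbPow (-(2 * a)) y
          ≤ jbPow (2 * s) x * ∫⁻ y in S, D * jbPow (-(2 * b)) x * jbPow (-(2 * a)) y := by
            gcongr jbPow (2 * s) x * ?_
            refine setLIntegral_mono (by fun_prop) fun y hy ↦ ?_
            gcongr
            refine jbPow_le_mul_of_comparable _ ?_ ?_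
            · linarith [norm_sub_le x y, hy.1]
            · linarith [norm_sub_norm_le x y, hy.2]
        _ ≤ jbPow (2 * s) x * ∫⁻ y in Metric.closedBall (0 : EuclideanSpace ℝ (Fin m)) ‖x‖,
              D * jbPow (-(2 * b)) x * jbPow (-(2 * a)) y := by
            gcongr jbPow (2 * s) x * ?_
            exact lintegral_mono_set fun y hy ↦ mem_closedBall_zero_iff.2 hy.1
        _ = D * (jbPow (-(2 * (b - s))) x *
              ∫⁻ y in Metric.closedBall (0 : EuclideanSpace ℝ (Fin m)) ‖x‖, jbPow (-(2 * a)) y) := by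
            rw [lintegral_const_mul _ (hw _),
              show -(2 * (b - s)) = 2 * s + -(2 * b) by ring, ← jbPow_mul]
            ring
        _ ≤ D * C := by gcongr; exact hbd x
    calc jbPow (2 * s) x * (∫⁻ y in S, F y * G (x - y)) ^ 2
        ≤ jbPow (2 * s) x * ((∫⁻ y in S, A y * B (x - y)) *
          ∫⁻ y in S, jbPow (-(2 * b)) (x - y) * jbPow (-(2 * a)) y) := by gcongr
      _ = (jbPow (2 * s) x * ∫⁻ y in S, jbPow (-(2 * b)) (x - y) * jbPow (-(2 * a)) y) *
          ∫⁻ y in S, A y * B (x - y) := by ring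
      _ ≤ D * C * ∫⁻ y, A y * B (x - y) := by gcongr; exact Measure.restrict_le_self
  calc _ ≤ ∫⁻ x, D * C * ∫⁻ y, A y * B (x - y) := lintegral_mono hpt
    _ = D * C * ∫⁻ x, ∫⁻ y, A y * B (x - y) :=
        lintegral_const_mul _ (Measurable.lintegral_prod_right (by fun_prop))
    _ = D * C * ∫⁻ y, ∫⁻ x, A y * B (x - y) := by
        rw [lintegral_lintegral_swap (by fun_prop)]
    _ = D * C * ∫⁻ y, A y * ∫⁻ z, B z := by
        congr 1
        refine lintegral_congr fun y ↦ ?_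
        rw [lintegral_const_mul _ (by fun_prop), lintegral_sub_right_eq_self B]
    _ = _ := by rw [lintegral_mul_const _ hAm, ← mul_assoc]

lemma exists_lintegral_conv_sq_le_of_output_small (hab : 0 ≤ a + b)
    (hs : s ≤ a + b - (m : ℝ) / 2) (hs' : -s = (m : ℝ) / 2 → s < a + b - (m : ℝ) / 2) :
    ∃ C : ℝ≥0∞, C ≠ ∞ ∧ ∀ F G : EuclideanSpace ℝ (Fin m) → ℝ≥0∞, Measurable F → Measurable G →
      ∫⁻ x, jbPow (2 * s) x *
          (∫⁻ y in {y | ‖x‖ ≤ ‖y‖ ∧ ‖x‖ ≤ ‖x - y‖}, F y * G (x - y)) ^ 2 ≤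
        C * (∫⁻ y, jbPow (2 * a) y * F y ^ 2) * ∫⁻ z, jbPow (2 * b) z * G z ^ 2 := by
  obtain ⟨C, hC, hbd⟩ := exists_jbPow_mul_setLIntegral_le (m := m) (α := -s) (σ := a + b)
    hab (by linarith) (fun h ↦ by linarith [hs' h])
  refine ⟨ENNReal.ofReal (2 ^ |-(2 * a)|) * C, ENNReal.mul_ne_top ENNReal.ofReal_ne_top hC,
    fun F G hF hG ↦ ?_⟩
  set D := ENNReal.ofReal (2 ^ |-(2 * a)|)
  set A := ∫⁻ y, jbPow (2 * a) y * F y ^ 2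
  have hw (p : ℝ) := measurable_jbPow (E := EuclideanSpace ℝ (Fin m)) p
  let H : EuclideanSpace ℝ (Fin m) → ℝ≥0∞ := fun z ↦ jbPow (-(2 * a)) z * G z ^ 2
  have hH : Measurable H := by fun_prop
  let K : EuclideanSpace ℝ (Fin m) → EuclideanSpace ℝ (Fin m) → ℝ≥0∞ := fun x z ↦
    {p : EuclideanSpace ℝ (Fin m) × EuclideanSpace ℝ (Fin m) | ‖p.1‖ ≤ ‖p.2‖}.indicator
      (fun p ↦ jbPow (2 * s) p.1 * H p.2) (x, z)
  have hK : Measurable (Function.uncurry K) :=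
    Measurable.indicator (by fun_prop) (measurableSet_le (by fun_prop) (by fun_prop))
  have hpt (x : EuclideanSpace ℝ (Fin m)) : jbPow (2 * s) x *
      (∫⁻ y in {y | ‖x‖ ≤ ‖y‖ ∧ ‖x‖ ≤ ‖x - y‖}, F y * G (x - y)) ^ 2 ≤
      D * A * ∫⁻ z, K x z := by
    set S := {y : EuclideanSpace ℝ (Fin m) | ‖x‖ ≤ ‖y‖ ∧ ‖x‖ ≤ ‖x - y‖}
    have hcs : (∫⁻ y in S, F y * G (x - y)) ^ 2 ≤ A *
        ∫⁻ y in S, jbPow (-(2 * a)) y * G (x - y) ^ 2 := by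
      have h := lintegral_mul_sq_le (volume.restrict S)
        (f := fun y ↦ jbPow a y * F y) (g := fun y ↦ jbPow (-a) y * G (x - y))
        (by fun_prop) (by fun_prop)
      simp only [mul_pow, jbPow_sq, mul_neg] at h
      calc (∫⁻ y in S, F y * G (x - y)) ^ 2
          = (∫⁻ y in S, jbPow a y * F y * (jbPow (-a) y * G (x - y))) ^ 2 := by
            congr 1
            refine lintegral_congr fun y ↦ ?_
            calc F y * G (x - y) = jbPow (a + -a) y * (F y * G (x - y)) := by simp
              _ = _ := by rw [← jbPow_mul]; ring
        _ ≤ _ := h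
        _ ≤ _ := by gcongr; exact setLIntegral_le_lintegral _ _
    have hker : jbPow (2 * s) x * ∫⁻ y in S, jbPow (-(2 * a)) y * G (x - y) ^ 2 ≤
        D * ∫⁻ z, K x z := by
      rw [← lintegral_sub_left_eq_self (K x) x, ← lintegral_const_mul _ (by fun_prop),
        ← lintegral_const_mul _ (by fun_prop)]
      refine le_trans ?_ (setLIntegral_le_lintegral S _)
      refine setLIntegral_mono (by fun_prop) fun y hy ↦ ?_
      have hKx : K x (x - y) = jbPow (2 * s) x * (jbPow (-(2 * a)) (x - y) * G (x - y) ^ 2) :=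
        Set.indicator_of_mem (a := (x, x - y)) hy.2 _
      rw [hKx]
      calc jbPow (2 * s) x * (jbPow (-(2 * a)) y * G (x - y) ^ 2)
          ≤ jbPow (2 * s) x * (D * jbPow (-(2 * a)) (x - y) * G (x - y) ^ 2) := by
            gcongr
            refine jbPow_le_mul_of_comparable _ ?_ ?_
            · have := norm_sub_norm_le y x
              rw [norm_sub_rev] at this
              linarith [hy.2]
            · linarith [norm_sub_le x y, hy.1]
        _ = _ := by ring
    calc jbPow (2 * s) x * (∫⁻ y in S, F y * G (x - y)) ^ 2
        ≤ jbPow (2 * s) x * (A * ∫⁻ y in S, jbPow (-(2 * a)) y * G (x - y) ^ 2) := by gcongr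
      _ = A * (jbPow (2 * s) x * ∫⁻ y in S, jbPow (-(2 * a)) y * G (x - y) ^ 2) := by ring
      _ ≤ A * (D * ∫⁻ z, K x z) := by gcongr
      _ = _ := by ring
  have hKz (z : EuclideanSpace ℝ (Fin m)) :
      ∫⁻ x, K x z ≤ C * (jbPow (2 * b) z * G z ^ 2) := by
    have hKi (x : EuclideanSpace ℝ (Fin m)) : K x z =
        (Metric.closedBall (0 : EuclideanSpace ℝ (Fin m)) ‖z‖).indicator
          (fun x ↦ jbPow (2 * s) x * H z) x := by
      by_cases h : ‖x‖ ≤ ‖z‖ <;> simp [K, h]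
    simp only [hKi]
    rw [lintegral_indicator measurableSet_closedBall, lintegral_mul_const _ (hw _)]
    calc (∫⁻ x in Metric.closedBall (0 : EuclideanSpace ℝ (Fin m)) ‖z‖, jbPow (2 * s) x) * H z
        = (jbPow (-(2 * (a + b))) z *
            ∫⁻ x in Metric.closedBall (0 : EuclideanSpace ℝ (Fin m)) ‖z‖, jbPow (-(2 * -s)) x) *
            (jbPow (2 * b) z * G z ^ 2) := by
          simp only [H]
          rw [show -(2 * a) = -(2 * (a + b)) + 2 * b by ring, ← jbPow_mul, mul_neg, neg_neg]
          ring
      _ ≤ _ := by gcongr; exact hbd z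
  calc _ ≤ ∫⁻ x, D * A * ∫⁻ z, K x z := lintegral_mono hpt
    _ = D * A * ∫⁻ x, ∫⁻ z, K x z := lintegral_const_mul _ hK.lintegral_prod_right
    _ = D * A * ∫⁻ z, ∫⁻ x, K x z := by rw [lintegral_lintegral_swap hK.aemeasurable]
    _ ≤ D * A * ∫⁻ z, C * (jbPow (2 * b) z * G z ^ 2) := by gcongr with z; exact hKz z
    _ = _ := by rw [lintegral_const_mul _ (by fun_prop)]; ring

lemma measurableSet_norm_le_and_norm_le_sub (x : EuclideanSpace ℝ (Fin m)) :
    MeasurableSet {y : EuclideanSpace ℝ (Fin m) | ‖y‖ ≤ ‖x‖ ∧ ‖y‖ ≤ ‖x - y‖} := by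
  have h₁ : MeasurableSet {y : EuclideanSpace ℝ (Fin m) | ‖y‖ ≤ ‖x‖} :=
    measurableSet_le (by fun_prop) (by fun_prop)
  have h₂ : MeasurableSet {y : EuclideanSpace ℝ (Fin m) | ‖y‖ ≤ ‖x - y‖} :=
    measurableSet_le (by fun_prop) (by fun_prop)
  exact h₁.inter h₂

lemma measurable_setLIntegral_sub_of_norm_le (hF : Measurable F) (hG : Measurable G) :
    Measurable fun x ↦ ∫⁻ y in {y | ‖y‖ ≤ ‖x‖ ∧ ‖y‖ ≤ ‖x - y‖}, F y * G (x - y) := by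
  have hs (x : EuclideanSpace ℝ (Fin m)) :
      MeasurableSet {y : EuclideanSpace ℝ (Fin m) | ‖y‖ ≤ ‖x‖ ∧ ‖y‖ ≤ ‖x - y‖} :=
    measurableSet_norm_le_and_norm_le_sub x
  have h₁ : MeasurableSet
      {p : EuclideanSpace ℝ (Fin m) × EuclideanSpace ℝ (Fin m) | ‖p.2‖ ≤ ‖p.1‖} :=
    measurableSet_le (by fun_prop) (by fun_prop)
  have h₂ : MeasurableSet
      {p : EuclideanSpace ℝ (Fin m) × EuclideanSpace ℝ (Fin m) | ‖p.2‖ ≤ ‖p.1 - p.2‖} :=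
    measurableSet_le (by fun_prop) (by fun_prop)
  simp_rw [← lintegral_indicator (hs _)]
  exact (Measurable.indicator (f := fun p : EuclideanSpace ℝ (Fin m) × EuclideanSpace ℝ (Fin m) ↦
    F p.2 * G (p.1 - p.2)) (by fun_prop) (h₁.inter h₂)).lintegral_prod_right'

lemma lintegral_conv_le_three_regions (F G : EuclideanSpace ℝ (Fin m) → ℝ≥0∞)
    (x : EuclideanSpace ℝ (Fin m)) :
    ∫⁻ y, F y * G (x - y) ≤
      (∫⁻ y in {y | ‖y‖ ≤ ‖x‖ ∧ ‖y‖ ≤ ‖x - y‖}, F y * G (x - y)) +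
      (∫⁻ y in {y | ‖y‖ ≤ ‖x‖ ∧ ‖y‖ ≤ ‖x - y‖}, G y * F (x - y)) +
      ∫⁻ y in {y | ‖x‖ ≤ ‖y‖ ∧ ‖x‖ ≤ ‖x - y‖}, F y * G (x - y) := by
  set S := {y : EuclideanSpace ℝ (Fin m) | ‖y‖ ≤ ‖x‖ ∧ ‖y‖ ≤ ‖x - y‖} with hS
  set T := {y : EuclideanSpace ℝ (Fin m) | ‖x‖ ≤ ‖y‖ ∧ ‖x‖ ≤ ‖x - y‖} with hT
  have hSm : MeasurableSet S := measurableSet_norm_le_and_norm_le_sub x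
  have hS2 : ∫⁻ y in S, G y * F (x - y) = ∫⁻ y in (x - ·) ⁻¹' S, F y * G (x - y) := by
    rw [← lintegral_indicator hSm, ← lintegral_indicator (hSm.preimage (by fun_prop)),
      ← lintegral_sub_left_eq_self _ x]
    refine lintegral_congr fun y ↦ ?_
    by_cases h : x - y ∈ S <;> simp [h, mul_comm]
  rw [hS2]
  have hcover : Set.univ ⊆ (S ∪ (x - ·) ⁻¹' S) ∪ T := by
    intro y _
    simp only [hS, hT, Set.mem_union, Set.mem_ofPred_eq, Set.mem_preimage, sub_sub_cancel]
    grind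
  calc ∫⁻ y, F y * G (x - y) = ∫⁻ y in Set.univ, F y * G (x - y) := by simp
    _ ≤ ∫⁻ y in (S ∪ (x - ·) ⁻¹' S) ∪ T, F y * G (x - y) := lintegral_mono_set hcover
    _ ≤ _ := (lintegral_union_le _ _ _).trans (by gcongr; exact lintegral_union_le _ _ _)

end Convolution

theorem stmt_15 (m : ℕ) (a b s : ℝ)
    (hab : 0 ≤ a + b) (hs_min : s ≤ min a b) (hs : s ≤ a + b - (m : ℝ) / 2)
    (hstrict : (-s = (m : ℝ) / 2 ∨ a = (m : ℝ) / 2 ∨ b = (m : ℝ) / 2) →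
      s < a + b - (m : ℝ) / 2) :
    ∃ C : ℝ, 0 < C ∧
      ∀ F G : EuclideanSpace ℝ (Fin m) → ℝ≥0∞, Measurable F → Measurable G →
        (∫⁻ x, ENNReal.ofReal (jb x ^ (2 * s)) * (∫⁻ y, F y * G (x - y)) ^ 2) ^ (1 / 2 : ℝ)
          ≤ ENNReal.ofReal C
            * (∫⁻ y, ENNReal.ofReal (jb y ^ (2 * a)) * (F y) ^ 2) ^ (1 / 2 : ℝ)
            * (∫⁻ z, ENNReal.ofReal (jb z ^ (2 * b)) * (G z) ^ 2) ^ (1 / 2 : ℝ) := by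
  obtain ⟨C₁, hC₁, h₁⟩ := exists_lintegral_conv_sq_le_of_left_small (m := m) (a := a) (b := b)
    (s := s) (hs_min.trans (min_le_right _ _)) hs (fun h ↦ hstrict (.inr (.inl h)))
  obtain ⟨C₂, hC₂, h₂⟩ := exists_lintegral_conv_sq_le_of_left_small (m := m) (a := b) (b := a)
    (s := s) (hs_min.trans (min_le_left _ _)) (by linarith)
    (fun h ↦ by linarith [hstrict (.inr (.inr h))])
  obtain ⟨C₃, hC₃, h₃⟩ := exists_lintegral_conv_sq_le_of_output_small (m := m) (a := a) (b := b)
    (s := s) hab hs (fun h ↦ hstrict (.inl h))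
  set K := 9 * (C₁ + C₂ + C₃)
  have hKtop : K ^ (1 / 2 : ℝ) ≠ ∞ := by
    refine ENNReal.rpow_ne_top_of_nonneg (by norm_num) (ENNReal.mul_ne_top (by simp) ?_)
    simp [hC₁, hC₂, hC₃]
  refine ⟨(K ^ (1 / 2 : ℝ)).toReal + 1, by positivity, fun F G hF hG ↦ ?_⟩
  have hKle : K ^ (1 / 2 : ℝ) ≤ ENNReal.ofReal ((K ^ (1 / 2 : ℝ)).toReal + 1) :=
    (ENNReal.le_ofReal_iff_toReal_le hKtop (by positivity)).2 (by linarith)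
  change (∫⁻ x, jbPow (2 * s) x * (∫⁻ y, F y * G (x - y)) ^ 2) ^ (1 / 2 : ℝ) ≤
    _ * (∫⁻ y, jbPow (2 * a) y * F y ^ 2) ^ (1 / 2 : ℝ) *
      (∫⁻ z, jbPow (2 * b) z * G z ^ 2) ^ (1 / 2 : ℝ)
  specialize h₁ F G hF hG
  specialize h₂ G F hG hF
  specialize h₃ F G hF hG
  set A := ∫⁻ y, jbPow (2 * a) y * F y ^ 2
  set B := ∫⁻ z, jbPow (2 * b) z * G z ^ 2
  have hmain : ∫⁻ x, jbPow (2 * s) x * (∫⁻ y, F y * G (x - y)) ^ 2 ≤ K * A * B := by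
    set I₁ := fun x ↦ ∫⁻ y in {y | ‖y‖ ≤ ‖x‖ ∧ ‖y‖ ≤ ‖x - y‖}, F y * G (x - y)
    set I₂ := fun x ↦ ∫⁻ y in {y | ‖y‖ ≤ ‖x‖ ∧ ‖y‖ ≤ ‖x - y‖}, G y * F (x - y)
    set I₃ := fun x ↦ ∫⁻ y in {y | ‖x‖ ≤ ‖y‖ ∧ ‖x‖ ≤ ‖x - y‖}, F y * G (x - y)
    have hI₁ : Measurable I₁ := measurable_setLIntegral_sub_of_norm_le hF hG
    have hI₂ : Measurable I₂ := measurable_setLIntegral_sub_of_norm_le hG hF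
    have hw := measurable_jbPow (E := EuclideanSpace ℝ (Fin m)) (2 * s)
    calc ∫⁻ x, jbPow (2 * s) x * (∫⁻ y, F y * G (x - y)) ^ 2
        ≤ ∫⁻ x, 9 * (jbPow (2 * s) x * I₁ x ^ 2 + jbPow (2 * s) x * I₂ x ^ 2 +
            jbPow (2 * s) x * I₃ x ^ 2) := by
          refine lintegral_mono fun x ↦ ?_
          calc jbPow (2 * s) x * (∫⁻ y, F y * G (x - y)) ^ 2
              ≤ jbPow (2 * s) x * (9 * (I₁ x ^ 2 + I₂ x ^ 2 + I₃ x ^ 2)) := by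
                gcongr
                exact (pow_le_pow_left' (lintegral_conv_le_three_regions F G x) 2).trans
                  (add_add_sq_le _ _ _)
            _ = _ := by ring
      _ = 9 * ((∫⁻ x, jbPow (2 * s) x * I₁ x ^ 2) + (∫⁻ x, jbPow (2 * s) x * I₂ x ^ 2) +
            ∫⁻ x, jbPow (2 * s) x * I₃ x ^ 2) := by
          rw [lintegral_const_mul' _ _ (by simp), lintegral_add_left (by fun_prop),
            lintegral_add_left (by fun_prop)]
      _ ≤ 9 * (C₁ * A * B + C₂ * B * A + C₃ * A * B) := by gcongr
      _ = K * A * B := by ring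
  grw [hmain, ← hKle]
  rw [ENNReal.mul_rpow_of_nonneg _ _ (by norm_num), ENNReal.mul_rpow_of_nonneg _ _ (by norm_num)]
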